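/- Let g : I × I → ℝ be smooth near the diagonal and φ : I → I be a smooth monotone function. Define g̃(t₀,t₁) = φ'(t₀)φ'(t₁)·g(φ(t₀),φ(t₁)) + k·(φ'(t₀)φ'(t₁)/(φ(t₀)−φ(t₁))² − 1/(t₀−t₁)²) for t₀ ≠ t₁. Then g̃ extends smoothly to the diagonal, and its diagonal value is g̃(t,t) = φ'(t)²·g(φ(t),φ(t)) + (k/3)·S(φ)(t), where S(φ) is the Schwarzian derivative. -/

import Mathlib

/-- Schwarzian derivative. -/
noncomputable def schwarzian (f : ℝ → ℝ) (t : ℝ) : ℝ :=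
  (1 / 2) * iteratedDeriv 3 f t / deriv f t
    - (3 / 4) * (deriv (deriv f) t / deriv f t) ^ 2

/-- Weighted average of `f` over the segment from `p.2` to `p.1`. -/
noncomputable def segAvg (w f : ℝ → ℝ) (p : ℝ × ℝ) : ℝ :=
  ∫ s in (0 : ℝ)..1, w s * f (p.2 + s * (p.1 - p.2))

lemma segAvg_hasFDerivAt (w f : ℝ → ℝ) (hw : Continuous w) (hf : ContDiff ℝ (⊤ : ℕ∞) f)
    (p : ℝ × ℝ) :
    HasFDerivAt (segAvg w f)
      (segAvg (fun s => s * w s) (deriv f) p • ContinuousLinearMap.fst ℝ ℝ ℝ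
        + segAvg (fun s => (1 - s) * w s) (deriv f) p • ContinuousLinearMap.snd ℝ ℝ ℝ) p := by
  have hfc : Continuous f := hf.continuous
  have hfd : Continuous (deriv f) := hf.continuous_deriv (by simp)
  have hdf : Differentiable ℝ f := hf.differentiable (by simp)
  set F' : ℝ × ℝ → ℝ → (ℝ × ℝ →L[ℝ] ℝ) := fun q s =>
    (s * w s * deriv f (q.2 + s * (q.1 - q.2))) • ContinuousLinearMap.fst ℝ ℝ ℝ
      + ((1 - s) * w s * deriv f (q.2 + s * (q.1 - q.2))) • ContinuousLinearMap.snd ℝ ℝ ℝ with hF'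
  have hF'c : Continuous (Function.uncurry F') := by
    simp only [hF', Function.uncurry_def]
    fun_prop
  obtain ⟨C, hC⟩ := ((isCompact_closedBall p 1).prod
    (isCompact_Icc (a := (0 : ℝ)) (b := 1))).exists_bound_of_continuousOn hF'c.continuousOn
  have key := intervalIntegral.hasFDerivAt_integral_of_dominated_of_fderiv_le (𝕜 := ℝ)
    (μ := MeasureTheory.volume) (a := 0) (b := 1) (bound := fun _ => C)
    (F := fun q s => w s * f (q.2 + s * (q.1 - q.2))) (F' := F') (x₀ := p)
    (Metric.closedBall_mem_nhds p one_pos)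
    (Filter.Eventually.of_forall fun q => Continuous.aestronglyMeasurable (by fun_prop))
    (Continuous.intervalIntegrable (by fun_prop) _ _)
    (Continuous.aestronglyMeasurable (by fun_prop))
    (Filter.Eventually.of_forall fun t ht q hq => by
      rw [Set.uIoc_of_le zero_le_one] at ht
      exact hC (q, t) ⟨hq, ht.1.le, ht.2⟩)
    (by simp)
    (Filter.Eventually.of_forall fun t _ q _ => by
      have h1 : HasFDerivAt (fun q : ℝ × ℝ => q.2 + t * (q.1 - q.2))
          (ContinuousLinearMap.snd ℝ ℝ ℝ +
            t • (ContinuousLinearMap.fst ℝ ℝ ℝ - ContinuousLinearMap.snd ℝ ℝ ℝ)) q :=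
        hasFDerivAt_snd.add ((hasFDerivAt_fst.sub hasFDerivAt_snd).const_mul t)
      have h2 := ((hdf (q.2 + t * (q.1 - q.2))).hasDerivAt.comp_hasFDerivAt q h1).const_mul (w t)
      refine h2.congr_fderiv ?_
      ext <;> simp [hF'] <;> ring)
  refine key.congr_fderiv ?_
  simp only [hF', segAvg]
  rw [intervalIntegral.integral_add, intervalIntegral.integral_smul_const,
    intervalIntegral.integral_smul_const]
  · exact Continuous.intervalIntegrable (by fun_prop) _ _
  · exact Continuous.intervalIntegrable (by fun_prop) _ _

lemma segAvg_contDiff_nat (n : ℕ) : ∀ (w f : ℝ → ℝ), Continuous w → ContDiff ℝ (⊤ : ℕ∞) f →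
    ContDiff ℝ n (segAvg w f) := by
  induction n with
  | zero =>
    intro w f hw hf
    rw [Nat.cast_zero, contDiff_zero, continuous_iff_continuousAt]
    exact fun p => (segAvg_hasFDerivAt w f hw hf p).continuousAt
  | succ n ih =>
    intro w f hw hf
    have hf' : ContDiff ℝ (⊤ : ℕ∞) (deriv f) := (contDiff_infty_iff_deriv.1 hf).2
    rw [Nat.cast_succ]
    refine (contDiff_succ_iff_hasFDerivAt (n := n)).2 ⟨_, ?_, segAvg_hasFDerivAt w f hw hf⟩
    exact ((ih _ _ (by fun_prop) hf').smul contDiff_const).add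
      ((ih _ _ (by fun_prop) hf').smul contDiff_const)

lemma segAvg_contDiff (w f : ℝ → ℝ) (hw : Continuous w) (hf : ContDiff ℝ (⊤ : ℕ∞) f) :
    ContDiff ℝ (⊤ : ℕ∞) (segAvg w f) :=
  contDiff_infty.2 fun n => segAvg_contDiff_nat n w f hw hf

/-- Integration by parts along the segment. -/
lemma segAvg_parts (w w' f : ℝ → ℝ) (hw : ∀ s, HasDerivAt w (w' s) s) (hw' : Continuous w')
    (hf : ContDiff ℝ (⊤ : ℕ∞) f) (x y : ℝ) :
    (x - y) * segAvg w (deriv f) (x, y) = w 1 * f x - w 0 * f y - segAvg w' f (x, y) := by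
  have hfd : Continuous (deriv f) := hf.continuous_deriv (by simp)
  have hdf : Differentiable ℝ f := hf.differentiable (by simp)
  have h := intervalIntegral.integral_mul_deriv_eq_deriv_mul (a := 0) (b := 1)
    (u := w) (u' := w') (v := fun s => f (y + s * (x - y)))
    (v' := fun s => deriv f (y + s * (x - y)) * (x - y))
    (fun s _ => hw s)
    (fun s _ => by
      have h1 : HasDerivAt (fun s : ℝ => y + s * (x - y)) (x - y) s := by
        simpa using ((hasDerivAt_id s).mul_const (x - y)).const_add y
      exact (hdf (y + s * (x - y))).hasDerivAt.comp s h1)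
    (hw'.intervalIntegrable _ _)
    (Continuous.intervalIntegrable (by fun_prop) _ _)
  simp only [segAvg]
  rw [← intervalIntegral.integral_const_mul]
  calc _ = ∫ s in (0 : ℝ)..1, w s * (deriv f (y + s * (x - y)) * (x - y)) := by
        congr 1; ext s; ring
    _ = _ := by rw [h]; simp

lemma segAvg_diag (w f : ℝ → ℝ) (t : ℝ) :
    segAvg w f (t, t) = (∫ s in (0 : ℝ)..1, w s) * f t := by
  simp [segAvg]

/-- The reparametrized generating function extends smoothly to the diagonal and its
diagonal value involves the Schwarzian derivative. -/
theorem reparametrization_rule (k : ℝ) (g : ℝ × ℝ → ℝ) (φ : ℝ → ℝ)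
    (hg : ContDiff ℝ (⊤ : ℕ∞) g) (hφ : ContDiff ℝ (⊤ : ℕ∞) φ) (hφ' : ∀ t, 0 < deriv φ t) :
    ∃ G : ℝ × ℝ → ℝ, ContDiff ℝ (⊤ : ℕ∞) G ∧
      (∀ t₀ t₁ : ℝ, t₀ ≠ t₁ →
        G (t₀, t₁) = deriv φ t₀ * deriv φ t₁ * g (φ t₀, φ t₁)
          + k * (deriv φ t₀ * deriv φ t₁ / (φ t₀ - φ t₁) ^ 2 - 1 / (t₀ - t₁) ^ 2)) ∧
      (∀ t : ℝ, G (t, t) = (deriv φ t) ^ 2 * g (φ t, φ t) + (k / 3) * schwarzian φ t) := by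
  have h1 : ContDiff ℝ (⊤ : ℕ∞) (deriv φ) := (contDiff_infty_iff_deriv.1 hφ).2
  have h2 : ContDiff ℝ (⊤ : ℕ∞) (deriv (deriv φ)) := (contDiff_infty_iff_deriv.1 h1).2
  have h3 : ContDiff ℝ (⊤ : ℕ∞) (deriv (deriv (deriv φ))) := (contDiff_infty_iff_deriv.1 h2).2
  set H := segAvg (fun _ => 1) (deriv φ) with hH
  set A := segAvg (fun s => s) (deriv (deriv φ)) with hA
  set B := segAvg (fun s => 1 - s) (deriv (deriv φ)) with hB
  set C := segAvg (fun s => s - s ^ 2) (deriv (deriv (deriv φ))) with hC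
  have cH : ContDiff ℝ (⊤ : ℕ∞) H := segAvg_contDiff _ _ (by fun_prop) h1
  have cA : ContDiff ℝ (⊤ : ℕ∞) A := segAvg_contDiff _ _ (by fun_prop) h2
  have cB : ContDiff ℝ (⊤ : ℕ∞) B := segAvg_contDiff _ _ (by fun_prop) h2
  have cC : ContDiff ℝ (⊤ : ℕ∞) C := segAvg_contDiff _ _ (by fun_prop) h3
  have Hne : ∀ p, H p ≠ 0 := by
    intro p
    have hc : Continuous (deriv φ) := h1.continuous
    refine (intervalIntegral.intervalIntegral_pos_of_pos
      (Continuous.intervalIntegrable (by fun_prop) _ _) (fun s => ?_) zero_lt_one).ne'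
    simpa using hφ' _
  have eH : ∀ x y, (x - y) * H (x, y) = φ x - φ y := by
    intro x y
    have := segAvg_parts (fun _ => 1) (fun _ => 0) φ (fun s => hasDerivAt_const s 1)
      continuous_const hφ x y
    rw [hH, this]; simp [segAvg]
  have eA : ∀ x y, (x - y) * A (x, y) = deriv φ x - H (x, y) := by
    intro x y
    have := segAvg_parts (fun s => s) (fun _ => 1) (deriv φ) (fun s => hasDerivAt_id s)
      continuous_const h1 x y
    rw [hA, this]; simp [hH]
  have eB : ∀ x y, (x - y) * B (x, y) = H (x, y) - deriv φ y := by
    intro x y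
    have := segAvg_parts (fun s => 1 - s) (fun _ => -1) (deriv φ)
      (fun s => (hasDerivAt_id s).const_sub 1) continuous_const h1 x y
    rw [hB, this]; simp [hH, segAvg]; ring
  have eC : ∀ x y, (x - y) * C (x, y) = A (x, y) - B (x, y) := by
    intro x y
    have := segAvg_parts (fun s => s - s ^ 2) (fun s => 1 - 2 * s) (deriv (deriv φ))
      (fun s => by
        have h := (hasDerivAt_id s).sub (hasDerivAt_pow 2 s)
        norm_num at h
        exact h) (by fun_prop) h2 x y
    have hc : Continuous (deriv (deriv φ)) := h2.continuous
    rw [hC, this]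
    simp only [hA, hB, segAvg]
    rw [← intervalIntegral.integral_sub (Continuous.intervalIntegrable (by fun_prop) _ _)
      (Continuous.intervalIntegrable (by fun_prop) _ _)]
    simp only [one_pow, sub_self, zero_mul, ne_eq, OfNat.ofNat_ne_zero, not_false_eq_true,
      zero_pow, zero_sub]
    rw [← intervalIntegral.integral_neg]
    congr 1; ext s; ring
  refine ⟨fun p => deriv φ p.1 * deriv φ p.2 * g (φ p.1, φ p.2)
    + k * ((H p * C p - A p * B p) / H p ^ 2), ?_, ?_, ?_⟩
  · refine ContDiff.add ?_ (contDiff_const.mul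
      (((cH.mul cC).sub (cA.mul cB)).div (cH.pow 2) fun p => pow_ne_zero 2 (Hne p)))
    exact ((h1.comp contDiff_fst).mul (h1.comp contDiff_snd)).mul
      (hg.comp ((hφ.comp contDiff_fst).prodMk (hφ.comp contDiff_snd)))
  · intro x y hxy
    have hd : x - y ≠ 0 := sub_ne_zero.2 hxy
    have hn := Hne (x, y)
    have e1 : deriv φ x = H (x, y) + (x - y) * A (x, y) := by rw [eA]; ring
    have e2 : deriv φ y = H (x, y) - (x - y) * B (x, y) := by rw [eB]; ring
    have e3 : A (x, y) = B (x, y) + (x - y) * C (x, y) := by rw [eC]; ring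
    have : (H (x, y) * C (x, y) - A (x, y) * B (x, y)) / H (x, y) ^ 2
        = deriv φ x * deriv φ y / (φ x - φ y) ^ 2 - 1 / (x - y) ^ 2 := by
      rw [← eH, e1, e2, e3]
      field_simp
      ring
    simp only [this]
  · intro t
    have hn := (hφ' t).ne'
    have dH : H (t, t) = deriv φ t := by rw [hH, segAvg_diag]; simp
    have dA : A (t, t) = deriv (deriv φ) t / 2 := by
      rw [hA, segAvg_diag, integral_id]; ring
    have dB : B (t, t) = deriv (deriv φ) t / 2 := by
      have := eC t t
      rw [← dA]; linarith
    have dC : C (t, t) = deriv (deriv (deriv φ)) t / 6 := by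
      rw [hC, segAvg_diag, intervalIntegral.integral_sub
        (Continuous.intervalIntegrable (by fun_prop) _ _)
        (Continuous.intervalIntegrable (by fun_prop) _ _), integral_id, integral_pow]
      norm_num; ring
    have h3' : iteratedDeriv 3 φ t = deriv (deriv (deriv φ)) t := by
      simp [iteratedDeriv_succ, iteratedDeriv_zero]
    simp only [dH, dA, dB, dC, schwarzian, h3']
    field_simp
    ring
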